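/- The symmetrization map intertwines the Moyal product with the Weyl algebra product: for all f, g ∈ R[h], φ_W(f *_h g) = φ_W(f) · φ_W(g) in A_h. In other words, transporting the multiplication of the Weyl algebra through the bijection φ_W yields exactly the Moyal star product on R[h]. -/

import Mathlib

open scoped TensorProduct

noncomputable section

/-- `R k n` is the polynomial ring `k[x_1,…,x_n,y_1,…,y_n]`, with the `x` variables
indexed by `Sum.inl` and the `y` variables indexed by `Sum.inr`. -/
abbrev MoyalR (k : Type) [Field k] (n : ℕ) : Type := MvPolynomial (Fin n ⊕ Fin n) k

/-- The bivector operator `π = Σ_i (∂/∂x_i ⊗ ∂/∂y_i − ∂/∂y_i ⊗ ∂/∂x_i)`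
acting on `R ⊗[k] R`. -/
def moyalPi (k : Type) [Field k] (n : ℕ) :
    MoyalR k n ⊗[k] MoyalR k n →ₗ[k] MoyalR k n ⊗[k] MoyalR k n :=
  ∑ i : Fin n,
    (TensorProduct.map (MvPolynomial.pderiv (Sum.inl i)).toLinearMap
        (MvPolynomial.pderiv (Sum.inr i)).toLinearMap
      - TensorProduct.map (MvPolynomial.pderiv (Sum.inr i)).toLinearMap
        (MvPolynomial.pderiv (Sum.inl i)).toLinearMap)

/-- The Moyal product of two elements of `R`, landing in `R[h]` (with `h = Polynomial.X`):
`f *_h g = Σ_{d≥0} (h^d/(2^d d!)) · m(π^d(f ⊗ g))`.  The sum is truncated at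
`totalDegree f + totalDegree g`, beyond which all terms vanish. -/
def moyalAux {k : Type} [Field k] {n : ℕ} (f g : MoyalR k n) : Polynomial (MoyalR k n) :=
  ∑ d ∈ Finset.range (f.totalDegree + g.totalDegree + 1),
    Polynomial.C (((2 ^ d * d.factorial : k)⁻¹) •
        LinearMap.mul' k (MoyalR k n) (((moyalPi k n) ^ d) (f ⊗ₜ[k] g))) *
      Polynomial.X ^ d

/-- The `k[h]`-bilinear extension of the Moyal product to `R[h] = Polynomial R`. -/
def moyal {k : Type} [Field k] {n : ℕ} (F G : Polynomial (MoyalR k n)) :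
    Polynomial (MoyalR k n) :=
  ∑ i ∈ F.support, ∑ j ∈ G.support,
    Polynomial.X ^ (i + j) * moyalAux (F.coeff i) (G.coeff j)


/-- The defining relations of the Weyl algebra `A_h` over `k[h]`:
`X_iX_j = X_jX_i`, `Y_iY_j = Y_jY_i`, `X_iY_j = Y_jX_i + h·δ_ij`. -/
inductive weylRel (k : Type) [Field k] (n : ℕ) :
    FreeAlgebra (Polynomial k) (Fin n ⊕ Fin n) →
      FreeAlgebra (Polynomial k) (Fin n ⊕ Fin n) → Prop
  | xx (i j : Fin n) : weylRel k n
      (FreeAlgebra.ι (Polynomial k) (Sum.inl i) * FreeAlgebra.ι (Polynomial k) (Sum.inl j))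
      (FreeAlgebra.ι (Polynomial k) (Sum.inl j) * FreeAlgebra.ι (Polynomial k) (Sum.inl i))
  | yy (i j : Fin n) : weylRel k n
      (FreeAlgebra.ι (Polynomial k) (Sum.inr i) * FreeAlgebra.ι (Polynomial k) (Sum.inr j))
      (FreeAlgebra.ι (Polynomial k) (Sum.inr j) * FreeAlgebra.ι (Polynomial k) (Sum.inr i))
  | xy (i j : Fin n) : weylRel k n
      (FreeAlgebra.ι (Polynomial k) (Sum.inl i) * FreeAlgebra.ι (Polynomial k) (Sum.inr j))
      (FreeAlgebra.ι (Polynomial k) (Sum.inr j) * FreeAlgebra.ι (Polynomial k) (Sum.inl i)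
        + if i = j then algebraMap (Polynomial k) _ Polynomial.X else 0)

/-- The Weyl algebra `A_h`, as a quotient of the free `k[h]`-algebra on the `2n`
generators by the Weyl relations. -/
abbrev WeylAlg (k : Type) [Field k] (n : ℕ) : Type := RingQuot (weylRel k n)

/-- The generator `Z_v` of the Weyl algebra corresponding to the variable `z_v`. -/
def weylGen (k : Type) [Field k] (n : ℕ) (v : Fin n ⊕ Fin n) : WeylAlg k n :=
  RingQuot.mkAlgHom (Polynomial k) (weylRel k n) (FreeAlgebra.ι (Polynomial k) v)

/-- The symmetrization `(1/m!) Σ_{σ ∈ S_m} Z_{i_σ(1)} ⋯ Z_{i_σ(m)}` of the word of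
generators determined by a monomial exponent `e`. -/
def symWord (k : Type) [Field k] (n : ℕ) (e : (Fin n ⊕ Fin n) →₀ ℕ) : WeylAlg k n :=
  let l := (Finsupp.toMultiset e).toList
  algebraMap (Polynomial k) (WeylAlg k n) (Polynomial.C ((l.length.factorial : k)⁻¹)) *
    ∑ σ : Equiv.Perm (Fin l.length),
      (List.ofFn fun i => weylGen k n (l.get (σ i))).prod

/-- The symmetrization map `φ_W : R[h] → A_h`: the `k[h]`-linear map sending each
commutative monomial to the average of all its noncommutative orderings in `A_h`. -/
def phiW (k : Type) [Field k] (n : ℕ) (F : Polynomial (MoyalR k n)) : WeylAlg k n :=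
  ∑ i ∈ F.support,
    algebraMap (Polynomial k) (WeylAlg k n) (Polynomial.X ^ i) *
      ∑ e ∈ (F.coeff i).support,
        algebraMap (Polynomial k) (WeylAlg k n)
            (Polynomial.C (MvPolynomial.coeff e (F.coeff i))) * symWord k n e

/-- The sum of all the products of the family `w` taken in every order. -/
def permSum {A : Type*} [Ring A] {m : ℕ} (w : Fin m → A) : A :=
  ∑ σ : Equiv.Perm (Fin m), (List.ofFn fun i => w (σ i)).prod

theorem permSum_comp_perm {A : Type*} [Ring A] {m : ℕ} (w : Fin m → A)
    (σ : Equiv.Perm (Fin m)) : permSum (fun i => w (σ i)) = permSum w :=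
  Equiv.sum_comp (Equiv.mulLeft σ)
    fun τ : Equiv.Perm (Fin m) => (List.ofFn fun i => w (τ i)).prod

theorem permSum_succ {A : Type*} [Ring A] {m : ℕ} (w : Fin (m + 1) → A) :
    permSum w = ∑ p, w p * permSum fun i : Fin m => w (Equiv.swap 0 p i.succ) := by
  simp only [permSum]
  rw [← Equiv.sum_comp Equiv.Perm.decomposeFin.symm, Fintype.sum_prod_type]
  refine Finset.sum_congr rfl fun p _ => ?_
  rw [Finset.mul_sum]
  refine Finset.sum_congr rfl fun σ _ => ?_
  simp [List.ofFn_succ]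

theorem exists_perm_of_map_univ_eq {V : Type*} {m : ℕ} {w w' : Fin m → V}
    (h : Finset.univ.val.map w = Finset.univ.val.map w') :
    ∃ σ : Equiv.Perm (Fin m), ∀ i, w' (σ i) = w i := by
  classical
  have hcard : ∀ v, Nonempty ({i // w i = v} ≃ {i // w' i = v}) := fun v => by
    refine Fintype.card_eq.mp ?_
    have := congrArg (Multiset.count v) h
    simp only [Multiset.count_map] at this
    rw [Fintype.card_subtype, Fintype.card_subtype]
    simpa [Finset.card, Finset.filter, eq_comm] using this
  let ψ := fun v => (hcard v).some
  refine ⟨(Equiv.sigmaFiberEquiv w).symm.trans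
    ((Equiv.sigmaCongrRight ψ).trans (Equiv.sigmaFiberEquiv w')), fun i => ?_⟩
  exact (ψ (w i) ⟨i, rfl⟩).2

theorem symWord_eq_permSum {k : Type} [Field k] {n m : ℕ} {e : (Fin n ⊕ Fin n) →₀ ℕ}
    {w : Fin m → Fin n ⊕ Fin n} (hw : Finset.univ.val.map w = Finsupp.toMultiset e) :
    symWord k n e = (m.factorial : k)⁻¹ • permSum fun i => weylGen k n (w i) := by
  have key : ∀ l : List (Fin n ⊕ Fin n), (l : Multiset _) = Finset.univ.val.map w →
      algebraMap (Polynomial k) (WeylAlg k n) (Polynomial.C ((l.length.factorial : k)⁻¹)) *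
        (permSum fun i => weylGen k n (l.get i)) =
      (m.factorial : k)⁻¹ • permSum fun i => weylGen k n (w i) := by
    intro l hl
    obtain rfl : l.length = m := by simpa using congrArg Multiset.card hl
    obtain ⟨σ, hσ⟩ := exists_perm_of_map_univ_eq (w := w) (w' := l.get) (by simp [← hl])
    rw [← permSum_comp_perm _ σ]
    simp only [hσ]
    rw [← Polynomial.algebraMap_eq, ← IsScalarTower.algebraMap_apply, Algebra.smul_def]
  exact key _ (by rw [hw, Multiset.coe_toList])

theorem degree_smul_of_eq_permSum {k A V : Type*} [Field k] [CharZero k] [Ring A] [Algebra k A]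
    [Fintype V] {Z : V → A} {T : (V →₀ ℕ) → A}
    (hT : ∀ {m : ℕ} {e : V →₀ ℕ} {w : Fin m → V},
      Finset.univ.val.map w = Finsupp.toMultiset e →
        T e = (m.factorial : k)⁻¹ • permSum fun i => Z (w i)) (e : V →₀ ℕ) :
    (e.degree : k) • T e = ∑ v, (e v : k) • (Z v * T (e - Finsupp.single v 1)) := by
  classical
  obtain ⟨m, w, hw, hm⟩ : ∃ (m : ℕ) (w : Fin m → V),
      Finset.univ.val.map w = Finsupp.toMultiset e ∧ e.degree = m := by
    refine ⟨_, (Finsupp.toMultiset e).toList.get, by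
      rw [Fin.univ_val_map, List.ofFn_get, Multiset.coe_toList], ?_⟩
    simp [Finsupp.card_toMultiset, Finsupp.degree_apply, Finsupp.sum]
  rw [hm]
  cases m with
  | zero =>
    obtain rfl : e = 0 := (Finsupp.degree_eq_zero_iff e).mp hm
    simp
  | succ m =>
    have hsum : ∀ F : V → A, ∑ v, (e v : k) • F v = ∑ p, F (w p) := by
      intro F
      have h := congrArg (fun s => (s.map F).sum) hw
      simp only [Multiset.map_map, Finset.sum_multiset_map_count, Finsupp.count_toMultiset] at h
      rw [← Finset.sum_multiset_map_count] at h
      refine Eq.trans ?_ h.symm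
      refine (Finset.sum_subset (Finset.subset_univ (Finsupp.toMultiset e).toFinset) fun v _ hv => ?_).symm.trans ?_
      · have : e v = 0 := by simpa using hv
        simp [this]
      · exact Finset.sum_congr rfl fun v _ => Nat.cast_smul_eq_nsmul _ _ _
    rw [hsum, hT hw, permSum_succ, smul_smul, Finset.smul_sum]
    refine Finset.sum_congr rfl fun p _ => ?_
    rw [hT (w := fun i : Fin m => w (Equiv.swap 0 p i.succ)), ← mul_smul_comm]
    · congr 2
      rw [Nat.factorial_succ]
      have := Nat.factorial_ne_zero m
      push_cast
      have : (m.factorial : k) ≠ 0 := by exact_mod_cast this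
      have : (m + 1 : k) ≠ 0 := by exact_mod_cast m.succ_ne_zero
      field_simp
    · have h : Finset.univ.val.map (fun i => w (Equiv.swap 0 p i)) = Finsupp.toMultiset e := by
        rw [← hw]
        conv_rhs => rw [← Multiset.map_univ_val_equiv (Equiv.swap 0 p), Multiset.map_map]
        rfl
      ext v
      have hv := congrArg (Multiset.count v) h
      rw [Finsupp.count_toMultiset] at hv ⊢
      rw [Finsupp.tsub_apply, ← hv, Finsupp.single_apply]
      simp [List.ofFn_succ, List.count_cons]

theorem pderiv_pderiv_comm {R σ : Type*} [CommRing R] (i j : σ) (f : MvPolynomial σ R) :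
    MvPolynomial.pderiv i (MvPolynomial.pderiv j f) =
      MvPolynomial.pderiv j (MvPolynomial.pderiv i f) := by
  classical
  have : ⁅MvPolynomial.pderiv (R := R) i, MvPolynomial.pderiv (R := R) j⁆ = 0 :=
    MvPolynomial.derivation_ext fun l => by
      simp [Derivation.commutator_apply, MvPolynomial.pderiv_X, Pi.single_apply, apply_ite]
  exact sub_eq_zero.mp ((Derivation.commutator_apply ..).symm.trans (congrArg (· f) this))

/-- The Poisson bracket `{z_v, ·}` with a coordinate function. -/
def poissonVar (k : Type) [Field k] {n : ℕ} (v : Fin n ⊕ Fin n) :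
    Derivation k (MoyalR k n) (MoyalR k n) :=
  Sum.elim (fun i => MvPolynomial.pderiv (Sum.inr i)) (fun i => -MvPolynomial.pderiv (Sum.inl i)) v

/-- The restriction of the symmetrization map to `R`, as a `k`-linear map. -/
def symMap (k : Type) [Field k] (n : ℕ) : MoyalR k n →ₗ[k] WeylAlg k n :=
  (MvPolynomial.basisMonomials (Fin n ⊕ Fin n) k).constr k (symWord k n)

theorem symMap_monomial {k : Type} [Field k] {n : ℕ} (e : (Fin n ⊕ Fin n) →₀ ℕ) (a : k) :
    symMap k n (MvPolynomial.monomial e a) = a • symWord k n e := by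
  have h : MvPolynomial.monomial e a = a • MvPolynomial.basisMonomials (Fin n ⊕ Fin n) k e := by
    simp [MvPolynomial.smul_monomial]
  rw [h, map_smul, symMap, Module.Basis.constr_basis]

theorem symMap_eq_sum {k : Type} [Field k] {n : ℕ} (f : MoyalR k n) :
    symMap k n f = ∑ e ∈ f.support, algebraMap (Polynomial k) (WeylAlg k n)
      (Polynomial.C (MvPolynomial.coeff e f)) * symWord k n e := by
  conv_lhs => rw [f.as_sum]
  rw [map_sum]
  refine Finset.sum_congr rfl fun e _ => ?_
  rw [symMap_monomial, ← Polynomial.algebraMap_eq, ← IsScalarTower.algebraMap_apply,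
    Algebra.smul_def]

theorem MvPolynomial.IsHomogeneous.smul_map_of_degree_smul {k A V : Type*} [Field k] [Ring A] [Algebra k A]
    [Fintype V] {Z : V → A} {T : (V →₀ ℕ) → A} {Φ : MvPolynomial V k →ₗ[k] A}
    (hΦ : ∀ e a, Φ (MvPolynomial.monomial e a) = a • T e)
    (hT : ∀ e : V →₀ ℕ,
      (e.degree : k) • T e = ∑ v, (e v : k) • (Z v * T (e - Finsupp.single v 1)))
    {m : ℕ} {f : MvPolynomial V k} (hf : f.IsHomogeneous m) :
    (m : k) • Φ f = ∑ v, Z v * Φ (MvPolynomial.pderiv v f) := by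
  rw [f.as_sum]
  simp only [map_sum, Finset.smul_sum, Finset.mul_sum]
  rw [Finset.sum_comm]
  refine Finset.sum_congr rfl fun e he => ?_
  obtain rfl : e.degree = m := by
    rw [Finsupp.degree_eq_weight_one]
    exact hf (MvPolynomial.mem_support_iff.mp he)
  simp only [MvPolynomial.pderiv_monomial, hΦ]
  rw [smul_comm, hT, Finset.smul_sum]
  exact Finset.sum_congr rfl fun v _ => by rw [smul_smul, mul_smul_comm]

/-- `Φ` is a symmetrization map to an algebra generated by `Z` subject to the Weyl relations
with central parameter `h`; symmetrization is expressed through Euler's recursion. -/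
structure IsWeylSymmetrization {k : Type} [Field k] {n : ℕ} {A : Type*} [Ring A] [Algebra k A]
    (Z : Fin n ⊕ Fin n → A) (h : A) (Φ : MoyalR k n →ₗ[k] A) : Prop where
  commute (a : A) : Commute h a
  xx (i j : Fin n) : Z (Sum.inl i) * Z (Sum.inl j) = Z (Sum.inl j) * Z (Sum.inl i)
  yy (i j : Fin n) : Z (Sum.inr i) * Z (Sum.inr j) = Z (Sum.inr j) * Z (Sum.inr i)
  xy (i j : Fin n) : Z (Sum.inl i) * Z (Sum.inr j) =
    Z (Sum.inr j) * Z (Sum.inl i) + if i = j then h else 0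
  map_one : Φ 1 = 1
  euler {m : ℕ} {f : MoyalR k n} (hf : f.IsHomogeneous m) :
    (m : k) • Φ f = ∑ v, Z v * Φ (MvPolynomial.pderiv v f)

theorem isWeylSymmetrization_symMap (k : Type) [Field k] [CharZero k] (n : ℕ) :
    IsWeylSymmetrization (weylGen k n)
      (algebraMap (Polynomial k) (WeylAlg k n) Polynomial.X) (symMap k n) where
  commute a := Algebra.commutes _ _
  xx i j := by
    have := RingQuot.mkAlgHom_rel (Polynomial k) (weylRel.xx (k := k) i j)
    rwa [map_mul, map_mul] at this
  yy i j := by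
    have := RingQuot.mkAlgHom_rel (Polynomial k) (weylRel.yy (k := k) i j)
    rwa [map_mul, map_mul] at this
  xy i j := by
    have := RingQuot.mkAlgHom_rel (Polynomial k) (weylRel.xy (k := k) i j)
    rw [map_mul, map_add, map_mul] at this
    refine this.trans ?_
    split_ifs <;> simp [weylGen]
  map_one := by
    have h : symWord k n 0 = 1 := by
      rw [symWord_eq_permSum (w := Fin.elim0) (by simp)]
      simp [permSum]
    rw [MvPolynomial.one_def, symMap_monomial, h, one_smul]
  euler hf := hf.smul_map_of_degree_smul (T := symWord k n) symMap_monomial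
    (fun e => degree_smul_of_eq_permSum (fun hw => symWord_eq_permSum hw) e)

theorem pderiv_poissonVar {k : Type} [Field k] {n : ℕ} (v w : Fin n ⊕ Fin n) (f : MoyalR k n) :
    MvPolynomial.pderiv w (poissonVar k v f) = poissonVar k v (MvPolynomial.pderiv w f) := by
  cases v <;> simp [poissonVar, pderiv_pderiv_comm w]

theorem isHomogeneous_poissonVar {k : Type} [Field k] {n m : ℕ} (v : Fin n ⊕ Fin n)
    {f : MoyalR k n} (hf : f.IsHomogeneous m) : (poissonVar k v f).IsHomogeneous (m - 1) := by
  cases v with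
  | inl i => exact hf.pderiv
  | inr i => exact hf.pderiv.neg

namespace IsWeylSymmetrization

variable {k : Type} [Field k] {n : ℕ} {A : Type*} [Ring A] [Algebra k A]
  {Z : Fin n ⊕ Fin n → A} {h : A} {Φ : MoyalR k n →ₗ[k] A}

theorem sum_mul_mul_map (H : IsWeylSymmetrization Z h Φ)
    (v : Fin n ⊕ Fin n) (f : MoyalR k n) :
    ∑ w, Z w * (Z v * Φ (MvPolynomial.pderiv w f)) =
      Z v * ∑ w, Z w * Φ (MvPolynomial.pderiv w f) -
        h * Φ (poissonVar k v f) := by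
  simp only [← mul_assoc, Fintype.sum_sum_type, mul_add, Finset.mul_sum]
  cases v with
  | inl i =>
    simp only [H.xy i, H.xx i, add_mul, Finset.sum_add_distrib,
      ite_mul, zero_mul, Finset.sum_ite_eq, Finset.mem_univ, if_true, poissonVar, Sum.elim_inl]
    abel
  | inr i =>
    simp only [fun j => H.xy j i, H.yy i, add_mul,
      Finset.sum_add_distrib, ite_mul, zero_mul, Finset.sum_ite_eq', Finset.mem_univ, if_true,
      poissonVar, Sum.elim_inr, Derivation.neg_apply, map_neg, mul_neg]
    abel

theorem sum_mul_map_pderiv_X_mul (Z : Fin n ⊕ Fin n → A) (Φ : MoyalR k n →ₗ[k] A)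
    (v : Fin n ⊕ Fin n) (f : MoyalR k n) :
    ∑ w, Z w * Φ (MvPolynomial.pderiv w (MvPolynomial.X v * f)) =
      Z v * Φ f + ∑ w, Z w * Φ (MvPolynomial.X v * MvPolynomial.pderiv w f) := by
  classical
  simp only [Derivation.leibniz, MvPolynomial.pderiv_X, smul_eq_mul, map_add, mul_add,
    Finset.sum_add_distrib]
  rw [add_comm, Finset.sum_eq_single v]
  · simp
  · intro w _ hw
    simp [Pi.single_eq_of_ne hw.symm]
  · simp

theorem mul_map_of_isHomogeneous [CharZero k] {m : ℕ} (H : IsWeylSymmetrization Z h Φ)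
    (v : Fin n ⊕ Fin n) {f : MoyalR k n} (hf : f.IsHomogeneous m) :
    Z v * Φ f = Φ (MvPolynomial.X v * f) + (2⁻¹ : k) • (h * Φ (poissonVar k v f)) := by
  induction m generalizing f with
  | zero =>
    have h1 := H.euler ((MvPolynomial.isHomogeneous_X k v).mul hf)
    rw [← MvPolynomial.totalDegree_zero_iff_isHomogeneous,
      MvPolynomial.totalDegree_eq_zero_iff_eq_C] at hf
    have hd : ∀ D : Derivation k (MoyalR k n) (MoyalR k n), D f = 0 := fun D => by
      rw [hf, MvPolynomial.derivation_C]
    rw [sum_mul_map_pderiv_X_mul] at h1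
    simpa [hd] using h1.symm
  | succ m ih =>
    have h1 := H.euler ((MvPolynomial.isHomogeneous_X k v).mul hf)
    have h2 := H.euler hf
    have h3 := H.euler (isHomogeneous_poissonVar v hf)
    have h4 : ∀ w, Φ (MvPolynomial.X v * MvPolynomial.pderiv w f) =
        Z v * Φ (MvPolynomial.pderiv w f) -
          (2⁻¹ : k) • (h * Φ (MvPolynomial.pderiv w (poissonVar k v f))) := by
      intro w
      rw [pderiv_poissonVar]
      exact eq_sub_of_add_eq (ih hf.pderiv).symm
    have h5 : ∑ w, Z w * (h * Φ (MvPolynomial.pderiv w (poissonVar k v f))) =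
        h * ((m : k) • Φ (poissonVar k v f)) := by
      rw [Nat.add_sub_cancel] at h3
      rw [h3, Finset.mul_sum]
      exact Finset.sum_congr rfl fun w _ => (H.commute _).symm.left_comm _
    rw [sum_mul_map_pderiv_X_mul] at h1
    simp only [h4, mul_sub, Finset.sum_sub_distrib, mul_smul_comm, ← Finset.smul_sum, h5,
      H.sum_mul_mul_map, ← h2] at h1
    push_cast at h1
    have hm : (1 + (m + 1) : k) ≠ 0 := by exact_mod_cast (1 + m).succ_ne_zero
    apply smul_right_injective _ hm
    simp only [smul_add, h1]
    module

theorem mul_map [CharZero k] (H : IsWeylSymmetrization Z h Φ) (v : Fin n ⊕ Fin n)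
    (f : MoyalR k n) :
    Z v * Φ f = Φ (MvPolynomial.X v * f) + (2⁻¹ : k) • (h * Φ (poissonVar k v f)) := by
  rw [f.as_sum]
  simp only [map_sum, Finset.mul_sum, Finset.smul_sum, ← Finset.sum_add_distrib]
  exact Finset.sum_congr rfl fun e _ =>
    H.mul_map_of_isHomogeneous v (MvPolynomial.isHomogeneous_monomial _ rfl)

end IsWeylSymmetrization

section MoyalOperators

variable {k : Type} [Field k] {n : ℕ}

/-- Multiplication of the left tensor factor by a coordinate function. -/
def mulLeftVar (k : Type) [Field k] {n : ℕ} (v : Fin n ⊕ Fin n) :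
    Module.End k (MoyalR k n ⊗[k] MoyalR k n) :=
  TensorProduct.map (LinearMap.mulLeft k (MvPolynomial.X v)) LinearMap.id

/-- The bracket `{z_v, ·}` applied to the left tensor factor. -/
def poissonLeft (k : Type) [Field k] {n : ℕ} (v : Fin n ⊕ Fin n) :
    Module.End k (MoyalR k n ⊗[k] MoyalR k n) :=
  TensorProduct.map (poissonVar k v).toLinearMap LinearMap.id

/-- The bracket `{z_v, ·}` applied to the right tensor factor. -/
def poissonRight (k : Type) [Field k] {n : ℕ} (v : Fin n ⊕ Fin n) :
    Module.End k (MoyalR k n ⊗[k] MoyalR k n) :=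
  TensorProduct.map LinearMap.id (poissonVar k v).toLinearMap

theorem moyalPi_tmul (f g : MoyalR k n) :
    moyalPi k n (f ⊗ₜ g) = ∑ i : Fin n,
      (MvPolynomial.pderiv (Sum.inl i) f ⊗ₜ[k] MvPolynomial.pderiv (Sum.inr i) g -
        MvPolynomial.pderiv (Sum.inr i) f ⊗ₜ[k] MvPolynomial.pderiv (Sum.inl i) g) := by
  simp [moyalPi, LinearMap.sum_apply]

theorem moyalPi_mul_mulLeftVar (v : Fin n ⊕ Fin n) :
    moyalPi k n * mulLeftVar k v = mulLeftVar k v * moyalPi k n + poissonRight k v := by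
  classical
  refine TensorProduct.ext' fun f g => ?_
  simp only [mulLeftVar, poissonRight, Module.End.mul_apply, LinearMap.add_apply,
    TensorProduct.map_tmul, LinearMap.mulLeft_apply, LinearMap.id_apply, moyalPi_tmul, map_sum,
    map_sub, Derivation.leibniz, MvPolynomial.pderiv_X, smul_eq_mul, TensorProduct.add_tmul]
  rw [← sub_eq_iff_eq_add', ← Finset.sum_sub_distrib]
  cases v with
  | inl i =>
    rw [Finset.sum_eq_single i]
    · simp [poissonVar]
    · intro j _ hj
      simp [hj.symm]
    · simp
  | inr i =>
    rw [Finset.sum_eq_single i]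
    · simp [poissonVar, TensorProduct.tmul_neg]
    · intro j _ hj
      simp [hj.symm]
    · simp

theorem commute_moyalPi_poissonLeft (v : Fin n ⊕ Fin n) :
    Commute (moyalPi k n) (poissonLeft k v) := by
  refine TensorProduct.ext' fun f g => ?_
  simp [poissonLeft, moyalPi_tmul, pderiv_poissonVar]

theorem commute_moyalPi_poissonRight (v : Fin n ⊕ Fin n) :
    Commute (moyalPi k n) (poissonRight k v) := by
  refine TensorProduct.ext' fun f g => ?_
  simp [poissonRight, moyalPi_tmul, pderiv_poissonVar]

theorem moyalPi_pow_mul_mulLeftVar (v : Fin n ⊕ Fin n) (d : ℕ) :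
    moyalPi k n ^ d * mulLeftVar k v =
      mulLeftVar k v * moyalPi k n ^ d + d • (moyalPi k n ^ (d - 1) * poissonRight k v) := by
  induction d with
  | zero => simp
  | succ d ih =>
    have hd : moyalPi k n * (d • (moyalPi k n ^ (d - 1) * poissonRight k v)) =
        d • (moyalPi k n ^ d * poissonRight k v) := by
      cases d with
      | zero => simp
      | succ d => rw [mul_smul_comm, ← mul_assoc, ← pow_succ', Nat.add_sub_cancel]
    rw [pow_succ', mul_assoc, ih, mul_add, ← mul_assoc, moyalPi_mul_mulLeftVar, hd, add_mul,
      mul_assoc, Nat.add_sub_cancel, ((commute_moyalPi_poissonRight v).pow_left d).eq, add_assoc,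
      succ_nsmul']

theorem mul'_mulLeftVar (v : Fin n ⊕ Fin n) (t : MoyalR k n ⊗[k] MoyalR k n) :
    LinearMap.mul' k (MoyalR k n) (mulLeftVar k v t) =
      MvPolynomial.X v * LinearMap.mul' k (MoyalR k n) t := by
  induction t with
  | zero => simp
  | add s t hs ht => simp only [map_add, hs, ht, mul_add]
  | tmul f g => simp [mulLeftVar, mul_assoc]

theorem poissonVar_mul' (v : Fin n ⊕ Fin n) (t : MoyalR k n ⊗[k] MoyalR k n) :
    poissonVar k v (LinearMap.mul' k (MoyalR k n) t) =
      LinearMap.mul' k (MoyalR k n) (poissonLeft k v t) +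
        LinearMap.mul' k (MoyalR k n) (poissonRight k v t) := by
  induction t with
  | zero => simp
  | add s t hs ht => simp only [map_add, hs, ht]; abel
  | tmul f g => simp [poissonLeft, poissonRight, mul_comm, add_comm]

theorem isHomogeneous_succ_induction {V : Type*} {m : ℕ} {motive : MvPolynomial V k → Prop}
    (zero : motive 0) (add : ∀ f g, motive f → motive g → motive (f + g))
    (X_mul : ∀ v f, f.IsHomogeneous m → motive (MvPolynomial.X v * f))
    {f : MvPolynomial V k} (hf : f.IsHomogeneous (m + 1)) : motive f := by
  classical
  rw [f.as_sum]
  refine Finset.sum_induction _ _ add zero fun e he => ?_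
  have hdeg : e.degree = m + 1 := by
    rw [Finsupp.degree_eq_weight_one]
    exact hf (MvPolynomial.mem_support_iff.mp he)
  obtain ⟨v, hv⟩ : ∃ v, e v ≠ 0 := by
    by_contra! h
    obtain rfl : e = 0 := Finsupp.ext h
    simp at hdeg
  have he' : e = Finsupp.single v 1 + (e - Finsupp.single v 1) :=
    (add_tsub_cancel_of_le (Finsupp.single_le_iff.mpr (Nat.one_le_iff_ne_zero.mpr hv))).symm
  rw [he', ← one_mul (MvPolynomial.coeff _ f), ← MvPolynomial.monomial_mul]
  refine X_mul v _ (MvPolynomial.isHomogeneous_monomial _ ?_)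
  rw [he', map_add, Finsupp.degree_single] at hdeg
  omega

theorem moyalPi_C_tmul (a : k) (g : MoyalR k n) :
    moyalPi k n (MvPolynomial.C a ⊗ₜ g) = 0 := by
  simp [moyalPi_tmul]

theorem moyalPi_pow_tmul_eq_zero {m d : ℕ} (hd : m < d) {f : MoyalR k n}
    (hf : f.IsHomogeneous m) (g : MoyalR k n) : (moyalPi k n ^ d) (f ⊗ₜ g) = 0 := by
  induction m generalizing d f g with
  | zero =>
    rw [← MvPolynomial.totalDegree_zero_iff_isHomogeneous,
      MvPolynomial.totalDegree_eq_zero_iff_eq_C] at hf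
    obtain ⟨d, rfl⟩ := Nat.exists_eq_succ_of_ne_zero hd.ne'
    rw [hf, pow_succ, Module.End.mul_apply, moyalPi_C_tmul, map_zero]
  | succ m ih =>
    refine isHomogeneous_succ_induction
      (motive := fun f => (moyalPi k n ^ d) (f ⊗ₜ g) = 0) (by simp)
      (fun f₁ f₂ h₁ h₂ => by rw [TensorProduct.add_tmul, map_add, h₁, h₂, add_zero])
      (fun v f hf => ?_) hf
    have h := LinearMap.congr_fun (moyalPi_pow_mul_mulLeftVar (k := k) v d) (f ⊗ₜ g)
    simp only [Module.End.mul_apply, LinearMap.add_apply, LinearMap.smul_apply] at h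
    rw [ih (by omega) hf g, map_zero, zero_add, poissonRight, TensorProduct.map_tmul,
      LinearMap.id_apply, ih (by omega) hf, smul_zero] at h
    exact h

end MoyalOperators

namespace IsWeylSymmetrization

variable {k : Type} [Field k] {n : ℕ} {A : Type*} [Ring A] [Algebra k A]
  {Z : Fin n ⊕ Fin n → A} {h : A} {Φ : MoyalR k n →ₗ[k] A}

/-- The image under `Φ` of the first `N` terms of the Moyal product. -/
def moyalTrunc (h : A) (Φ : MoyalR k n →ₗ[k] A) (N : ℕ) : MoyalR k n ⊗[k] MoyalR k n →ₗ[k] A :=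
  ∑ d ∈ Finset.range N, (2 ^ d * d.factorial : k)⁻¹ •
    (LinearMap.mulLeft k (h ^ d) ∘ₗ Φ ∘ₗ LinearMap.mul' k (MoyalR k n) ∘ₗ moyalPi k n ^ d)

theorem moyalTrunc_apply (N : ℕ) (t : MoyalR k n ⊗[k] MoyalR k n) :
    moyalTrunc h Φ N t = ∑ d ∈ Finset.range N, (2 ^ d * d.factorial : k)⁻¹ •
      (h ^ d * Φ (LinearMap.mul' k (MoyalR k n) ((moyalPi k n ^ d) t))) := by
  simp [moyalTrunc, LinearMap.sum_apply]

theorem moyalTrunc_mulLeftVar [CharZero k] (H : IsWeylSymmetrization Z h Φ) (v : Fin n ⊕ Fin n)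
    {N : ℕ} {t : MoyalR k n ⊗[k] MoyalR k n} (ht : (moyalPi k n ^ N) t = 0) :
    moyalTrunc h Φ (N + 1) (mulLeftVar k v t) =
      Z v * moyalTrunc h Φ N t -
        (2⁻¹ : k) • (h * moyalTrunc h Φ N (poissonLeft k v t)) := by
  have hM : ∀ d, (moyalPi k n ^ d) (mulLeftVar k v t) = mulLeftVar k v ((moyalPi k n ^ d) t) +
      d • (moyalPi k n ^ (d - 1)) (poissonRight k v t) := fun d => by
    simpa using LinearMap.congr_fun (moyalPi_pow_mul_mulLeftVar (k := k) v d) t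
  have hL : ∀ d, poissonLeft k v ((moyalPi k n ^ d) t) =
      (moyalPi k n ^ d) (poissonLeft k v t) := fun d =>
    (LinearMap.congr_fun ((commute_moyalPi_poissonLeft v).pow_left d).eq t).symm
  have hR : ∀ d, poissonRight k v ((moyalPi k n ^ d) t) =
      (moyalPi k n ^ d) (poissonRight k v t) := fun d =>
    (LinearMap.congr_fun ((commute_moyalPi_poissonRight v).pow_left d).eq t).symm
  have hZ : ∀ d (u : MoyalR k n), Z v * (h ^ d * Φ u) = h ^ d * Φ (MvPolynomial.X v * u) +
      (2⁻¹ : k) • (h ^ (d + 1) * Φ (poissonVar k v u)) := fun d u => by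
    rw [(((H.commute (Z v)).pow_left d).symm).left_comm, H.mul_map, mul_add, mul_smul_comm,
      ← mul_assoc, ← pow_succ]
  simp only [moyalTrunc_apply, hM, map_add, mul_add, smul_add, Finset.sum_add_distrib,
    mul'_mulLeftVar, map_nsmul]
  rw [Finset.sum_range_succ, ht, Finset.sum_range_succ']
  simp only [Finset.mul_sum, mul_smul_comm, hZ, poissonVar_mul', hL, hR, Finset.smul_sum, smul_add,
    map_add, mul_add, Finset.sum_add_distrib, ← mul_assoc, ← pow_succ', Nat.add_sub_cancel]
  have hc : ∀ d (a : A), (2 ^ (d + 1) * (d + 1).factorial : k)⁻¹ • (d + 1) • a =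
      (2 ^ d * d.factorial : k)⁻¹ • (2⁻¹ : k) • a := fun d a => by
    rw [← Nat.cast_smul_eq_nsmul k, smul_smul, smul_smul, Nat.factorial_succ]
    congr 1
    have h1 : (d.factorial : k) ≠ 0 := by exact_mod_cast d.factorial_ne_zero
    have h2 : (d + 1 : k) ≠ 0 := by exact_mod_cast d.succ_ne_zero
    push_cast
    field_simp
    ring
  simp only [hc, smul_comm (2⁻¹ : k), map_zero, mul_zero, smul_zero, zero_smul, add_zero]
  abel

theorem moyalTrunc_tmul_of_isHomogeneous [CharZero k] (H : IsWeylSymmetrization Z h Φ) {m N : ℕ}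
    (hN : m < N) {f : MoyalR k n} (hf : f.IsHomogeneous m) (g : MoyalR k n) :
    moyalTrunc h Φ N (f ⊗ₜ g) = Φ f * Φ g := by
  induction m using Nat.strong_induction_on generalizing N f g with
  | h m ih =>
    obtain ⟨N, rfl⟩ := Nat.exists_eq_succ_of_ne_zero (Nat.ne_zero_of_lt hN)
    cases m with
    | zero =>
      rw [← MvPolynomial.totalDegree_zero_iff_isHomogeneous,
        MvPolynomial.totalDegree_eq_zero_iff_eq_C] at hf
      have hΦ : ∀ a g, Φ (MvPolynomial.C a * g) = a • Φ g := fun a g => by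
        rw [MvPolynomial.C_mul', map_smul]
      have hΦ1 := hΦ (MvPolynomial.coeff 0 f) 1
      rw [mul_one, H.map_one] at hΦ1
      rw [hf, hΦ1, moyalTrunc_apply, Finset.sum_range_succ']
      simp [pow_succ, moyalPi_C_tmul, hΦ]
    | succ m =>
      refine isHomogeneous_succ_induction
        (motive := fun f => moyalTrunc h Φ (N + 1) (f ⊗ₜ g) = Φ f * Φ g) (by simp)
        (fun f₁ f₂ h₁ h₂ => by rw [TensorProduct.add_tmul, map_add, h₁, h₂, map_add, add_mul])
        (fun v f hf => ?_) hf
      have h1 := H.moyalTrunc_mulLeftVar v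
        (moyalPi_pow_tmul_eq_zero (Nat.lt_of_succ_lt_succ hN) hf g)
      rw [ih m (by omega) (by omega) hf, poissonLeft, TensorProduct.map_tmul,
        LinearMap.id_apply, Derivation.coeFn_coe,
        ih (m - 1) (by omega) (by omega) (isHomogeneous_poissonVar v hf), ← mul_assoc, H.mul_map,
        add_mul, smul_mul_assoc, mul_assoc, add_sub_cancel_right] at h1
      exact h1

theorem moyalTrunc_tmul [CharZero k] (H : IsWeylSymmetrization Z h Φ) {N : ℕ} {f : MoyalR k n}
    (hN : f.totalDegree < N) (g : MoyalR k n) :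
    moyalTrunc h Φ N (f ⊗ₜ g) = Φ f * Φ g := by
  have : ∀ e ∈ f.support, moyalTrunc h Φ N (MvPolynomial.monomial e (f.coeff e) ⊗ₜ g) =
      Φ (MvPolynomial.monomial e (f.coeff e)) * Φ g := fun e he =>
    H.moyalTrunc_tmul_of_isHomogeneous ((MvPolynomial.le_totalDegree he).trans_lt hN)
      (MvPolynomial.isHomogeneous_monomial _ rfl) g
  rw [f.as_sum, TensorProduct.sum_tmul, map_sum, map_sum, Finset.sum_mul]
  exact Finset.sum_congr rfl this

end IsWeylSymmetrization

section

variable {k : Type} [Field k] {n : ℕ}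

theorem phiW_eq_sum (F : Polynomial (MoyalR k n)) :
    phiW k n F = F.sum fun i f =>
      algebraMap (Polynomial k) (WeylAlg k n) Polynomial.X ^ i * symMap k n f := by
  simp only [phiW, Polynomial.sum, symMap_eq_sum, map_pow]

theorem phiW_add (F G : Polynomial (MoyalR k n)) :
    phiW k n (F + G) = phiW k n F + phiW k n G := by
  simp only [phiW_eq_sum]
  exact Polynomial.sum_add_index _ _ _ (by simp) (by simp [mul_add])

theorem phiW_sum {ι : Type*} (s : Finset ι) (F : ι → Polynomial (MoyalR k n)) :
    phiW k n (∑ i ∈ s, F i) = ∑ i ∈ s, phiW k n (F i) :=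
  map_sum (AddMonoidHom.mk' (phiW k n) phiW_add) F s

theorem phiW_C_mul_X_pow (f : MoyalR k n) (i : ℕ) :
    phiW k n (Polynomial.C f * Polynomial.X ^ i) =
      algebraMap (Polynomial k) (WeylAlg k n) Polynomial.X ^ i * symMap k n f := by
  rw [phiW_eq_sum, Polynomial.C_mul_X_pow_eq_monomial, Polynomial.sum_monomial_index]
  simp

theorem mul_mul_smul {A : Type*} [Ring A] [Algebra k A] (a b x : A) (c : k) :
    a * b * (c • x) = a * (c • (b * x)) := by
  rw [mul_smul_comm, mul_smul_comm, mul_assoc]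

theorem phiW_X_pow_mul_moyalAux [CharZero k] (p : ℕ) (f g : MoyalR k n) :
    phiW k n (Polynomial.X ^ p * moyalAux f g) =
      algebraMap (Polynomial k) (WeylAlg k n) Polynomial.X ^ p *
        (symMap k n f * symMap k n g) := by
  rw [← (isWeylSymmetrization_symMap k n).moyalTrunc_tmul (N := f.totalDegree + g.totalDegree + 1)
    (by omega), IsWeylSymmetrization.moyalTrunc_apply, moyalAux, Finset.mul_sum, phiW_sum]
  refine Eq.trans ?_ (Finset.mul_sum _ _ _).symm
  refine Finset.sum_congr rfl fun d _ => ?_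
  rw [mul_left_comm, ← pow_add, phiW_C_mul_X_pow, map_smul, pow_add]
  exact mul_mul_smul (k := k) (A := WeylAlg k n) _ _ _ _

end

/-- The symmetrization map intertwines the Moyal product with the Weyl algebra
product: `φ_W(f *_h g) = φ_W(f) · φ_W(g)`; i.e. transporting the Weyl algebra
multiplication through the bijection `φ_W` yields the Moyal star product. -/
theorem phiW_moyal (k : Type) [Field k] [CharZero k] (n : ℕ)
    (F G : Polynomial (MoyalR k n)) :
    phiW k n (moyal F G) = phiW k n F * phiW k n G := by
  rw [moyal, phiW_sum, phiW_eq_sum F, phiW_eq_sum G, Polynomial.sum, Polynomial.sum]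
  refine Eq.trans (Finset.sum_congr rfl fun i _ => ?_) (Finset.sum_mul _ _ _).symm
  rw [phiW_sum]
  refine Eq.trans (Finset.sum_congr rfl fun j _ => ?_) (Finset.mul_sum _ _ _).symm
  rw [phiW_X_pow_mul_moyalAux]
  generalize symMap k n (F.coeff i) = a
  generalize symMap k n (G.coeff j) = b
  have hc : Commute (algebraMap (Polynomial k) (WeylAlg k n) Polynomial.X) a :=
    Algebra.commutes _ _
  rw [pow_add, mul_assoc, mul_assoc, (hc.pow_left j).left_comm]
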